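/- For every n ≥ 1 and every t₀ > 0, the function t ↦ σ_n(t) has a derivative at t₀ satisfying r_n(t₀)² = σ_n(t₀) − 2 t₀ σ_n'(t₀) + 2(1 − (−1)^n) t₀. -/

import Mathlib

open MeasureTheory Polynomial

/-- The singularly perturbed Gaussian weight `w(x,t) = exp(-x^2 - t/x^2)` for `x ≠ 0`,
extended by `0` at `x = 0`. -/
noncomputable def w (t x : ℝ) : ℝ := if x = 0 then 0 else Real.exp (-x ^ 2 - t / x ^ 2)

/-! ### The weight and its integrals -/

@[simp] lemma w_zero (t : ℝ) : w t 0 = 0 := by simp [w]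

lemma w_of_ne {x : ℝ} (hx : x ≠ 0) (t : ℝ) : w t x = Real.exp (-x ^ 2 - t / x ^ 2) := by
  simp [w, hx]

lemma w_nonneg (t x : ℝ) : 0 ≤ w t x := by
  unfold w; split_ifs <;> positivity

lemma w_neg (t x : ℝ) : w t (-x) = w t x := by simp [w]

lemma measurable_w (t : ℝ) : Measurable (w t) := by
  unfold w
  exact Measurable.ite (measurableSet_singleton 0) (by fun_prop) (by fun_prop)

lemma w_antitone {s t : ℝ} (hst : s ≤ t) (x : ℝ) : w t x ≤ w s x := by
  unfold w; split_ifs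
  · rfl
  · gcongr

lemma pow_mul_exp_neg_le {t u : ℝ} (ht : 0 < t) (hu : 0 ≤ u) (m : ℕ) :
    u ^ m * Real.exp (-(t * u)) ≤ m.factorial / t ^ m := by
  have h := Real.pow_div_factorial_le_exp (t * u) (by positivity) m
  rw [div_le_iff₀ (by positivity), mul_pow] at h
  rw [Real.exp_neg, le_div_iff₀ (by positivity), ← div_eq_mul_inv, div_mul_eq_mul_div,
    div_le_iff₀ (Real.exp_pos _)]
  linarith

lemma w_div_pow_le {t : ℝ} (ht : 0 < t) (m : ℕ) (x : ℝ) :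
    w t x / x ^ (2 * m) ≤ m.factorial / t ^ m * Real.exp (-x ^ 2) := by
  rcases eq_or_ne x 0 with rfl | hx
  · simp only [w_zero, zero_div]; positivity
  · have h := pow_mul_exp_neg_le ht (u := 1 / x ^ 2) (by positivity) m
    have e : w t x / x ^ (2 * m)
        = (1 / x ^ 2) ^ m * Real.exp (-(t * (1 / x ^ 2))) * Real.exp (-x ^ 2) := by
      rw [w_of_ne hx, mul_assoc, ← Real.exp_add, pow_mul, div_pow, one_pow]
      rw [show -(t * (1 / x ^ 2)) + -x ^ 2 = -x ^ 2 - t / x ^ 2 by ring]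
      ring
    rw [e]
    gcongr

lemma integrable_eval_mul_gaussian (q : ℝ[X]) :
    Integrable fun x : ℝ => q.eval x * Real.exp (-x ^ 2) := by
  induction q using Polynomial.induction_on' with
  | add p q hp hq => simpa only [eval_add, add_mul] using! hp.add hq
  | monomial n a =>
    have h := (integrable_rpow_mul_exp_neg_mul_sq one_pos (s := n)
      (by linarith [n.cast_nonneg (α := ℝ)])).const_mul a
    simpa [mul_assoc] using h

lemma integrable_div_pow_mul_w {t : ℝ} (ht : 0 < t) (m : ℕ) (q : ℝ[X]) :
    Integrable fun x : ℝ => q.eval x / x ^ m * w t x := by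
  have hb := ((integrable_eval_mul_gaussian (q * X ^ m)).norm).const_mul (m.factorial / t ^ m)
  refine hb.mono' ?_ (Filter.Eventually.of_forall fun x => ?_)
  · exact (((q.continuous.measurable).div (by fun_prop)).mul (measurable_w t)).aestronglyMeasurable
  · rcases eq_or_ne x 0 with rfl | hx
    · simp only [w_zero, mul_zero, norm_zero]; positivity
    · have e : q.eval x / x ^ m * w t x = (q * X ^ m).eval x * (w t x / x ^ (2 * m)) := by
        simp only [eval_mul, eval_pow, eval_X]
        field_simp
        ring
      have h0 : 0 ≤ w t x / x ^ (2 * m) :=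
        div_nonneg (w_nonneg t x) (by rw [pow_mul]; positivity)
      rw [e, norm_mul, norm_mul, Real.norm_of_nonneg h0, Real.norm_of_nonneg (Real.exp_pos _).le]
      calc _ ≤ ‖(q * X ^ m).eval x‖ * (m.factorial / t ^ m * Real.exp (-x ^ 2)) := by
            gcongr; exact w_div_pow_le ht m x
        _ = _ := by ring

/-- The integral of `q(x) x⁻ᵐ` against the weight `w(x,t)`. -/
noncomputable def laurentIntegral (t : ℝ) (m : ℕ) (q : ℝ[X]) : ℝ :=
  ∫ x : ℝ, q.eval x / x ^ m * w t x

/-- `laurentIntegral` as a linear functional of the polynomial. -/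
noncomputable def laurentIntegralₗ {t : ℝ} (ht : 0 < t) (m : ℕ) : ℝ[X] →ₗ[ℝ] ℝ where
  toFun := laurentIntegral t m
  map_add' p q := by
    simp only [laurentIntegral]
    rw [← integral_add (integrable_div_pow_mul_w ht m p) (integrable_div_pow_mul_w ht m q)]
    simp [add_div, add_mul]
  map_smul' a q := by
    simp only [laurentIntegral, RingHom.id_apply, smul_eq_mul]
    rw [← integral_const_mul]
    simp [mul_div_assoc, mul_assoc]

lemma laurentIntegralₗ_apply {t : ℝ} (ht : 0 < t) (m : ℕ) (q : ℝ[X]) :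
    laurentIntegralₗ ht m q = laurentIntegral t m q := rfl

lemma laurentIntegral_add {t : ℝ} (ht : 0 < t) (m : ℕ) (p q : ℝ[X]) :
    laurentIntegral t m (p + q) = laurentIntegral t m p + laurentIntegral t m q :=
  map_add (laurentIntegralₗ ht m) p q

lemma laurentIntegral_sub {t : ℝ} (ht : 0 < t) (m : ℕ) (p q : ℝ[X]) :
    laurentIntegral t m (p - q) = laurentIntegral t m p - laurentIntegral t m q :=
  map_sub (laurentIntegralₗ ht m) p q

lemma laurentIntegral_C_mul {t : ℝ} (ht : 0 < t) (m : ℕ) (a : ℝ) (q : ℝ[X]) :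
    laurentIntegral t m (C a * q) = a * laurentIntegral t m q := by
  simpa only [smul_eq_C_mul, smul_eq_mul, laurentIntegralₗ_apply] using
    map_smul (laurentIntegralₗ ht m) a q

lemma laurentIntegral_X_mul (t : ℝ) (m : ℕ) (q : ℝ[X]) :
    laurentIntegral t (m + 1) (X * q) = laurentIntegral t m q := by
  refine integral_congr_ae (Filter.Eventually.of_forall fun x => ?_)
  rcases eq_or_ne x 0 with rfl | hx
  · simp
  · simp only [eval_mul, eval_X]
    field_simp
    ring

lemma laurentIntegral_comp_neg (t : ℝ) (m : ℕ) (q : ℝ[X]) :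
    laurentIntegral t m (q.comp (C (-1) * X)) = (-1) ^ m * laurentIntegral t m q := by
  unfold laurentIntegral
  rw [← integral_neg_eq_self, ← integral_const_mul]
  refine integral_congr_ae (Filter.Eventually.of_forall fun x => ?_)
  simp only [eval_comp, eval_mul, eval_C, eval_X, w_neg, neg_mul, one_mul, neg_neg]
  rw [neg_pow x m]
  rcases neg_one_pow_eq_or ℝ m with h | h <;> rw [h] <;> simp [div_neg]

lemma laurentIntegral_mul_eq_sum {t : ℝ} (ht : 0 < t) (m : ℕ) {p : ℝ[X]} {N : ℕ}
    (hp : p.natDegree < N) (q : ℝ[X]) :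
    laurentIntegral t m (p * q)
      = ∑ k ∈ Finset.range N, p.coeff k * laurentIntegral t m (X ^ k * q) := by
  conv_lhs => rw [p.as_sum_range_C_mul_X_pow' hp, Finset.sum_mul]
  rw [← laurentIntegralₗ_apply ht, map_sum]
  refine Finset.sum_congr rfl fun k _ => ?_
  rw [laurentIntegralₗ_apply, mul_assoc, laurentIntegral_C_mul ht]

lemma hasDerivAt_w_space {t : ℝ} (ht : 0 < t) (x : ℝ) :
    HasDerivAt (w t) ((-2 * x + 2 * t / x ^ 3) * w t x) x := by
  rcases eq_or_ne x 0 with rfl | hx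
  · rw [w_zero, mul_zero, hasDerivAt_iff_isLittleO]
    have hO : (fun x => w t x) =O[nhds 0] fun x : ℝ => x ^ 2 := by
      refine Asymptotics.IsBigO.of_bound (1 / t) (Filter.Eventually.of_forall fun x => ?_)
      rw [Real.norm_of_nonneg (w_nonneg t x), Real.norm_of_nonneg (sq_nonneg x)]
      rcases eq_or_ne x 0 with rfl | hx
      · simp
      · have h := w_div_pow_le ht 1 x
        rw [mul_one, div_le_iff₀ (by positivity)] at h
        have h1 : Real.exp (-x ^ 2) ≤ 1 := Real.exp_le_one_iff.2 (by nlinarith)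
        calc w t x ≤ _ := h
          _ ≤ (1 : ℕ).factorial / t ^ 1 * 1 * x ^ 2 := by gcongr
          _ = _ := by simp
    have ho : (fun x : ℝ => x ^ 2) =o[nhds 0] fun x => x := by
      simpa using Asymptotics.isLittleO_pow_pow (𝕜 := ℝ) (one_lt_two)
    simpa using hO.trans_isLittleO ho
  · have h : HasDerivAt (fun y : ℝ => Real.exp (-y ^ 2 - t / y ^ 2))
        ((-2 * x + 2 * t / x ^ 3) * w t x) x := by
      have h1 : HasDerivAt (fun y : ℝ => -y ^ 2 - t / y ^ 2) (-2 * x + 2 * t / x ^ 3) x := by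
        have h2 := ((hasDerivAt_pow 2 x).neg).sub
          ((hasDerivAt_const x t).div (hasDerivAt_pow 2 x) (pow_ne_zero 2 hx))
        refine h2.congr_deriv ?_
        field_simp
        norm_num
        ring
      rw [w_of_ne hx, mul_comm]
      exact h1.exp
    refine h.congr_of_eventuallyEq ?_
    filter_upwards [isOpen_ne.mem_nhds hx] with y hy using w_of_ne hy t

lemma laurentIntegral_derivative {t : ℝ} (ht : 0 < t) (q : ℝ[X]) :
    laurentIntegral t 0 (derivative q) - 2 * laurentIntegral t 0 (X * q)
      + 2 * t * laurentIntegral t 3 q = 0 := by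
  have hi1 := integrable_div_pow_mul_w ht 0 (derivative q)
  have hi2 := (integrable_div_pow_mul_w ht 0 (X * q)).const_mul 2
  have hi3 := (integrable_div_pow_mul_w ht 3 q).const_mul (2 * t)
  have h := integral_eq_zero_of_hasDerivAt_of_integrable
    (f := fun x => q.eval x * w t x)
    (f' := fun x => (derivative q).eval x / x ^ 0 * w t x - 2 * ((X * q).eval x / x ^ 0 * w t x)
      + 2 * t * (q.eval x / x ^ 3 * w t x))
    (fun x => ((q.hasDerivAt x).mul (hasDerivAt_w_space ht x)).congr_deriv (by
      simp only [eval_mul, eval_X]; ring))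
    ((hi1.sub hi2).add hi3)
    (by simpa using integrable_div_pow_mul_w ht 0 q)
  have h12 := integral_sub hi1 hi2
  have h123 := integral_add (hi1.sub hi2) hi3
  simp only [Pi.sub_apply] at h123
  rw [h123, h12, integral_const_mul, integral_const_mul] at h
  exact h

lemma hasDerivAt_w_param (t x : ℝ) : HasDerivAt (fun s => w s x) (-(1 / x ^ 2) * w t x) t := by
  rcases eq_or_ne x 0 with rfl | hx
  · simpa using hasDerivAt_const t (0 : ℝ)
  · simp only [w_of_ne hx]
    have h : HasDerivAt (fun s : ℝ => -x ^ 2 - s / x ^ 2) (-(1 / x ^ 2)) t :=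
      ((hasDerivAt_id t).div_const (x ^ 2)).const_sub (-x ^ 2)
    rw [mul_comm]
    exact h.exp

lemma hasDerivAt_laurentIntegral {t : ℝ} (ht : 0 < t) (q : ℝ[X]) :
    HasDerivAt (fun s => laurentIntegral s 0 q) (-laurentIntegral t 2 q) t := by
  have h := (hasDerivAt_integral_of_dominated_loc_of_deriv_le (μ := volume)
    (F := fun s x => q.eval x / x ^ 0 * w s x)
    (F' := fun s x => -(q.eval x / x ^ 2 * w s x))
    (bound := fun x => ‖q.eval x / x ^ 2 * w (t / 2) x‖)
    (Ioi_mem_nhds (half_lt_self ht))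
    (by
      filter_upwards [Ioi_mem_nhds ht] with s hs
        using (integrable_div_pow_mul_w hs 0 q).aestronglyMeasurable)
    (integrable_div_pow_mul_w ht 0 q)
    (integrable_div_pow_mul_w ht 2 q).neg.aestronglyMeasurable
    (Filter.Eventually.of_forall fun x s hs => by
      rw [norm_neg, norm_mul, norm_mul, Real.norm_of_nonneg (w_nonneg s x),
        Real.norm_of_nonneg (w_nonneg (t / 2) x)]
      gcongr
      exact w_antitone (le_of_lt hs) x)
    (integrable_div_pow_mul_w (half_pos ht) 2 q).norm
    (Filter.Eventually.of_forall fun x s _ =>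
      ((hasDerivAt_w_param s x).const_mul (q.eval x / x ^ 0)).congr_deriv (by ring))).2
  rwa [integral_neg] at h

/-! ### Monic orthogonal families for a linear functional -/

section Orthogonal

variable {L : ℝ[X] →ₗ[ℝ] ℝ} {p : ℕ → ℝ[X]}

/-- `p` is a family of monic polynomials, `p n` of degree `n`, orthogonal with respect to `L`,
with positive square norms. -/
structure IsMonicOrthogonal (L : ℝ[X] →ₗ[ℝ] ℝ) (p : ℕ → ℝ[X]) : Prop where
  monic : ∀ n, (p n).Monic
  natDegree : ∀ n, (p n).natDegree = n
  orthogonal : ∀ m n, m ≠ n → L (p m * p n) = 0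
  pos : ∀ n, 0 < L (p n * p n)

namespace IsMonicOrthogonal

lemma coeff_self (hp : IsMonicOrthogonal L p) (n : ℕ) : (p n).coeff n = 1 := by
  have h := (hp.monic n).coeff_natDegree
  rwa [hp.natDegree n] at h

lemma coeff_of_lt (hp : IsMonicOrthogonal L p) {n k : ℕ} (h : n < k) : (p n).coeff k = 0 :=
  coeff_eq_zero_of_natDegree_lt (by rwa [hp.natDegree n])

lemma apply_mul_of_degree_lt_le (hp : IsMonicOrthogonal L p) {n : ℕ} :
    ∀ d ≤ n, ∀ q : ℝ[X], (∀ k, d ≤ k → q.coeff k = 0) → L (q * p n) = 0 := by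
  intro d
  induction d with
  | zero =>
    intro _ q hq
    have : q = 0 := by ext k; simp [hq k]
    simp [this]
  | succ d ih =>
    intro hd q hq
    have h := ih (by omega) (q - C (q.coeff d) * p d) (fun k hk => by
      rcases hk.eq_or_lt with rfl | hk
      · simp [hp.coeff_self]
      · simp [hq k hk, hp.coeff_of_lt hk])
    rwa [sub_mul, map_sub, mul_assoc, ← smul_eq_C_mul, map_smul, hp.orthogonal d n (by omega),
      smul_zero, sub_zero] at h

lemma apply_mul_eq_zero (hp : IsMonicOrthogonal L p) {n : ℕ} {q : ℝ[X]}
    (hq : ∀ k, n ≤ k → q.coeff k = 0) : L (q * p n) = 0 :=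
  hp.apply_mul_of_degree_lt_le n le_rfl q hq

lemma apply_mul_eq_coeff (hp : IsMonicOrthogonal L p) {n : ℕ} {q : ℝ[X]}
    (hq : ∀ k, n < k → q.coeff k = 0) : L (q * p n) = q.coeff n * L (p n * p n) := by
  have h := hp.apply_mul_eq_zero (n := n) (q := q - C (q.coeff n) * p n) (fun k hk => by
    rcases hk.eq_or_lt with rfl | hk
    · simp [hp.coeff_self]
    · simp [hq k hk, hp.coeff_of_lt hk])
  rw [sub_mul, map_sub, mul_assoc, ← smul_eq_C_mul, map_smul, smul_eq_mul] at h
  linarith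

lemma eq_zero_of_apply_mul (hp : IsMonicOrthogonal L p) :
    ∀ (n : ℕ) (q : ℝ[X]), (∀ k, n ≤ k → q.coeff k = 0) → (∀ m < n, L (q * p m) = 0) → q = 0 := by
  intro n
  induction n with
  | zero => intro q hq _; ext k; simp [hq k]
  | succ n ih =>
    intro q hq h
    have h1 := hp.apply_mul_eq_coeff (n := n) (q := q) hq
    rw [h n (by omega)] at h1
    have h2 : q.coeff n = 0 := by
      rcases mul_eq_zero.1 h1.symm with h2 | h2
      · exact h2
      · exact absurd h2 (hp.pos n).ne'
    refine ih q (fun k hk => ?_) (fun m hm => h m (by omega))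
    rcases hk.eq_or_lt with rfl | hk
    · exact h2
    · exact hq k hk

/-- Orthogonal polynomials of an even functional have parity. -/
lemma coeff_eq_neg_one_pow_mul (hp : IsMonicOrthogonal L p)
    (heven : ∀ q : ℝ[X], L (q.comp (C (-1) * X)) = L q) (n k : ℕ) :
    (p n).coeff k = (-1) ^ (n + k) * (p n).coeff k := by
  have h := hp.eq_zero_of_apply_mul n (p n - C ((-1) ^ n) * (p n).comp (C (-1) * X))
    (fun k hk => by
      rcases hk.eq_or_lt with rfl | hk
      · rw [coeff_sub, coeff_C_mul, comp_C_mul_X_coeff, hp.coeff_self, one_mul, ← mul_pow]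
        simp
      · rw [coeff_sub, coeff_C_mul, comp_C_mul_X_coeff, hp.coeff_of_lt hk]; simp)
    (fun m hm => by
      have h1 : L (p n * p m) = 0 := hp.orthogonal n m (by omega)
      have h2 : L ((p n).comp (C (-1) * X) * p m) = 0 := by
        rw [← heven, mul_comp, comp_assoc]
        have e : (C (-1) * X : ℝ[X]).comp (C (-1) * X) = X := by simp
        rw [e, comp_X, mul_comm]
        refine hp.apply_mul_eq_zero fun k hk => ?_
        rw [comp_C_mul_X_coeff, hp.coeff_of_lt (by omega), zero_mul]
      rw [sub_mul, map_sub, mul_assoc, ← smul_eq_C_mul, map_smul, h1, h2]; simp)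
  have h3 := congrArg (fun q : ℝ[X] => q.coeff k) h
  simp only [coeff_sub, coeff_C_mul, comp_C_mul_X_coeff, coeff_zero] at h3
  rw [pow_add]
  linarith

lemma coeff_eq_zero_of_odd (hp : IsMonicOrthogonal L p)
    (heven : ∀ q : ℝ[X], L (q.comp (C (-1) * X)) = L q) {n k : ℕ} (hnk : Odd (n + k)) :
    (p n).coeff k = 0 := by
  have h := hp.coeff_eq_neg_one_pow_mul heven n k
  rw [hnk.neg_one_pow] at h
  linarith

lemma apply_succ_mul_X (hp : IsMonicOrthogonal L p) (n : ℕ) :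
    L (X * p n * p (n + 1)) = L (p (n + 1) * p (n + 1)) := by
  rw [hp.apply_mul_eq_coeff (n := n + 1) (q := X * p n), coeff_X_mul, hp.coeff_self, one_mul]
  intro k hk
  obtain ⟨k, rfl⟩ := Nat.exists_eq_succ_of_ne_zero (by omega : k ≠ 0)
  rw [Nat.succ_eq_add_one, coeff_X_mul, hp.coeff_of_lt (by omega)]

/-- The three-term recurrence for an even functional. -/
lemma X_mul_succ (hp : IsMonicOrthogonal L p)
    (heven : ∀ q : ℝ[X], L (q.comp (C (-1) * X)) = L q) (n : ℕ) :
    X * p (n + 1) = p (n + 2) + C (L (p (n + 1) * p (n + 1)) / L (p n * p n)) * p n := by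
  rw [← sub_eq_zero]
  refine hp.eq_zero_of_apply_mul (n + 1) _ (fun k hk => ?_) (fun m hm => ?_)
  · obtain ⟨k, rfl⟩ := Nat.exists_eq_succ_of_ne_zero (by omega : k ≠ 0)
    rw [Nat.succ_eq_add_one, coeff_sub, coeff_X_mul, coeff_add, coeff_C_mul,
      hp.coeff_of_lt (n := n) (by omega)]
    rcases (by omega : k = n ∨ k = n + 1 ∨ n + 1 < k) with rfl | rfl | hk
    · rw [hp.coeff_eq_zero_of_odd heven ⟨k, by omega⟩,
        hp.coeff_eq_zero_of_odd heven ⟨k + 1, by omega⟩]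
      simp
    · simp [hp.coeff_self]
    · rw [hp.coeff_of_lt hk, hp.coeff_of_lt (by omega)]; simp
  · rw [sub_mul, map_sub, add_mul, map_add, mul_assoc (C _), ← smul_eq_C_mul, map_smul,
      hp.orthogonal (n + 2) m (by omega)]
    have e : X * p (n + 1) * p m = X * p m * p (n + 1) := by ring
    rw [e]
    rcases (by omega : m = n ∨ m < n) with rfl | hm
    · rw [hp.apply_succ_mul_X, smul_eq_mul, div_mul_cancel₀ _ (hp.pos m).ne']; simp
    · rw [hp.orthogonal n m (by omega), hp.apply_mul_eq_zero]
      · simp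
      · intro k hk
        obtain ⟨k, rfl⟩ := Nat.exists_eq_succ_of_ne_zero (by omega : k ≠ 0)
        rw [Nat.succ_eq_add_one, coeff_X_mul, hp.coeff_of_lt (by omega)]

lemma apply_X_sq_mul (hp : IsMonicOrthogonal L p)
    (heven : ∀ q : ℝ[X], L (q.comp (C (-1) * X)) = L q) (n : ℕ) :
    L (X ^ 2 * p n * p n)
      = ((X ^ 2 * p n).coeff n - (X ^ 2 * p (n + 2)).coeff (n + 2)) * L (p n * p n) := by
  have h := hp.apply_mul_eq_coeff (n := n) (q := X ^ 2 * p n - p (n + 2)) (fun k hk => by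
    rcases (Nat.succ_le_of_lt hk).eq_or_lt with rfl | hk
    · rw [coeff_sub, hp.coeff_eq_zero_of_odd heven (n := n + 2) ⟨n + 1, by omega⟩]
      rcases n with _ | n
      · simp [coeff_X_pow_mul']
      · rw [show (n + 1).succ = n + 2 from rfl, coeff_X_pow_mul,
          hp.coeff_eq_zero_of_odd heven ⟨n, by omega⟩, sub_zero]
    · obtain ⟨j, rfl⟩ := Nat.exists_eq_add_of_le' (show 2 ≤ k by omega)
      have hj : n ≤ j := by omega
      rw [coeff_sub, coeff_X_pow_mul]
      rcases hj.eq_or_lt with rfl | hj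
      · simp [hp.coeff_self]
      · rw [hp.coeff_of_lt hj, hp.coeff_of_lt (by omega), sub_zero])
  rw [sub_mul, map_sub, hp.orthogonal (n + 2) n (by omega), sub_zero, coeff_sub] at h
  rw [h, coeff_X_pow_mul]

lemma apply_derivative_mul (hp : IsMonicOrthogonal L p) (n : ℕ) :
    L (derivative (p (n + 1)) * p n) = (n + 1) * L (p n * p n) := by
  rw [hp.apply_mul_eq_coeff, coeff_derivative, hp.coeff_self, one_mul]
  intro k hk
  rw [coeff_derivative, hp.coeff_of_lt (by omega), zero_mul]

lemma apply_derivative_mul_of_le (hp : IsMonicOrthogonal L p) {m n : ℕ} (h : m ≤ n) :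
    L (derivative (p m) * p n) = 0 := by
  refine hp.apply_mul_eq_zero fun k hk => ?_
  rw [coeff_derivative, hp.coeff_of_lt (by omega), zero_mul]

lemma apply_X_mul_derivative_mul (hp : IsMonicOrthogonal L p) (n : ℕ) :
    L (X * derivative (p n) * p n) = n * L (p n * p n) := by
  have key : ∀ k, (X * derivative (p n)).coeff k = k * (p n).coeff k := by
    rintro (_ | k)
    · simp
    · rw [coeff_X_mul, coeff_derivative]; push_cast; ring
  rw [hp.apply_mul_eq_coeff, key, hp.coeff_self, mul_one]
  intro k hk
  rw [key, hp.coeff_of_lt hk, mul_zero]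

end IsMonicOrthogonal

end Orthogonal

/-! ### Identities for the orthogonal polynomials of the weight `w` -/

section Weight

variable {t : ℝ} {ht : 0 < t} {p : ℕ → ℝ[X]}

lemma laurentIntegralₗ_comp_neg (ht : 0 < t) (q : ℝ[X]) :
    laurentIntegralₗ ht 0 (q.comp (C (-1) * X)) = laurentIntegralₗ ht 0 q := by
  rw [laurentIntegralₗ_apply, laurentIntegralₗ_apply, laurentIntegral_comp_neg, pow_zero, one_mul]

namespace IsMonicOrthogonal

lemma laurentIntegral_two_sq (hp : IsMonicOrthogonal (laurentIntegralₗ ht 0) p) (n : ℕ) :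
    2 * t * laurentIntegral t 2 (p n * p n)
      = (2 * ((X ^ 2 * p n).coeff n - (X ^ 2 * p (n + 2)).coeff (n + 2)) - (2 * n + 1))
        * laurentIntegral t 0 (p n * p n) := by
  have h := laurentIntegral_derivative ht (X * (p n * p n))
  have h1 := hp.apply_X_mul_derivative_mul n
  have h2 := hp.apply_X_sq_mul (laurentIntegralₗ_comp_neg ht) n
  simp only [laurentIntegralₗ_apply] at h1 h2
  have e1 : derivative (X * (p n * p n))
      = p n * p n + (X * derivative (p n) * p n + X * derivative (p n) * p n) := by
    simp only [derivative_mul, derivative_X]; ring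
  have e2 : X * (X * (p n * p n)) = X ^ 2 * p n * p n := by ring
  rw [e1, e2, laurentIntegral_add ht, laurentIntegral_add ht, laurentIntegral_X_mul, h1, h2] at h
  linarith

lemma laurentIntegral_three_mul (hp : IsMonicOrthogonal (laurentIntegralₗ ht 0) p) (n : ℕ) :
    2 * t * laurentIntegral t 3 (p (n + 1) * p n)
      = 2 * laurentIntegral t 0 (p (n + 1) * p (n + 1))
        - (n + 1) * laurentIntegral t 0 (p n * p n) := by
  have h := laurentIntegral_derivative ht (p (n + 1) * p n)
  have h1 := hp.apply_derivative_mul n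
  have h2 := hp.apply_derivative_mul_of_le n.le_succ
  have h3 := hp.apply_succ_mul_X n
  simp only [laurentIntegralₗ_apply, Nat.succ_eq_add_one] at h1 h2 h3
  have e1 : derivative (p (n + 1) * p n)
      = derivative (p (n + 1)) * p n + derivative (p n) * p (n + 1) := by
    rw [derivative_mul]; ring
  have e2 : X * (p (n + 1) * p n) = X * p n * p (n + 1) := by ring
  rw [e1, e2, laurentIntegral_add ht, h1, h2, h3] at h
  linarith

lemma laurentIntegral_one_mul (hp : IsMonicOrthogonal (laurentIntegralₗ ht 0) p) (n : ℕ) :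
    laurentIntegral t 1 (p (n + 1) * p n)
      = (1 - (-1) ^ (n + 1)) / 2 * laurentIntegral t 0 (p n * p n) := by
  have hodd : ∀ k, Odd k → p k = X * (p k).divX := fun k hk => by
    have h := (p k).X_mul_divX_add
    rw [hp.coeff_eq_zero_of_odd (laurentIntegralₗ_comp_neg ht) (by simpa using hk), C_0,
      add_zero] at h
    exact h.symm
  rcases Nat.even_or_odd n with hn | hn
  · rw [hodd (n + 1) hn.add_one, mul_assoc, laurentIntegral_X_mul, ← laurentIntegralₗ_apply ht,
      hp.apply_mul_eq_coeff, coeff_divX, hp.coeff_self, hn.add_one.neg_one_pow,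
      laurentIntegralₗ_apply]
    · ring
    · intro k hk
      rw [coeff_divX, hp.coeff_of_lt (by omega)]
  · have e : p (n + 1) * p n = X * ((p n).divX * p (n + 1)) := by
      conv_lhs => rw [hodd n hn]
      ring
    rw [e, laurentIntegral_X_mul, ← laurentIntegralₗ_apply ht, hp.apply_mul_eq_zero,
      hn.add_one.neg_one_pow]
    · ring
    · intro k hk
      rw [coeff_divX, hp.coeff_of_lt (by omega)]

/-- The recurrence coefficient as a difference of subleading coefficients. -/
lemma laurentIntegral_sq_div (hp : IsMonicOrthogonal (laurentIntegralₗ ht 0) p) (n : ℕ) :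
    laurentIntegral t 0 (p (n + 1) * p (n + 1)) / laurentIntegral t 0 (p n * p n)
      = (X ^ 2 * p (n + 1)).coeff (n + 1) - (X ^ 2 * p (n + 2)).coeff (n + 2) := by
  have h := congrArg (fun q : ℝ[X] => q.coeff n) (hp.X_mul_succ (laurentIntegralₗ_comp_neg ht) n)
  simp only [coeff_add, coeff_C_mul, hp.coeff_self, laurentIntegralₗ_apply, mul_one] at h
  rw [coeff_X_pow_mul, show (X ^ 2 * p (n + 1) : ℝ[X]) = X * (X * p (n + 1)) by ring, coeff_X_mul]
  linarith

end IsMonicOrthogonal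

/-- Differentiating the orthogonality relations in the parameter: `D` is the coefficientwise
derivative of the `n`-th polynomial. -/
lemma exists_hasDerivAt_coeff {P : ℕ → ℝ → ℝ[X]}
    (hP : ∀ s (hs : 0 < s), IsMonicOrthogonal (laurentIntegralₗ hs 0) (fun n => P n s))
    (hcoeff : ∀ n k : ℕ, ∀ t : ℝ, 0 < t → DifferentiableAt ℝ (fun s => (P n s).coeff k) t)
    (ht : 0 < t) (n : ℕ) :
    ∃ D : ℝ[X], (∀ k, HasDerivAt (fun s => (P n s).coeff k) (D.coeff k) t) ∧
      (∀ k, n ≤ k + 1 → D.coeff k = 0) ∧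
      ∀ q : ℝ[X], (∀ k, n ≤ k → q.coeff k = 0) →
        laurentIntegral t 0 (D * q) = laurentIntegral t 2 (P n t * q) := by
  have hzero : ∀ k, n ≤ k + 1 → deriv (fun s => (P n s).coeff k) t = 0 := fun k hk => by
    have hev : (fun s => (P n s).coeff k) =ᶠ[nhds t] fun _ => if k = n then 1 else 0 := by
      filter_upwards [Ioi_mem_nhds ht] with s hs
      rcases (by omega : k = n ∨ n < k ∨ n = k + 1) with rfl | h | rfl
      · simpa using (hP s hs).coeff_self k
      · simpa [h.ne'] using (hP s hs).coeff_of_lt h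
      · simpa using (hP s hs).coeff_eq_zero_of_odd (laurentIntegralₗ_comp_neg hs)
          (n := k + 1) (k := k) ⟨k, by omega⟩
    rw [hev.deriv_eq, deriv_const]
  set D : ℝ[X] := ∑ k ∈ Finset.range (n + 1),
    C (deriv (fun s => (P n s).coeff k) t) * X ^ k with hD
  have hDc : ∀ k, D.coeff k = deriv (fun s => (P n s).coeff k) t := fun k => by
    simp only [hD, finsetSum_coeff, coeff_C_mul_X_pow, Finset.sum_ite_eq, Finset.mem_range]
    split_ifs with h
    · rfl
    · exact (hzero k (by omega)).symm
  have hderiv : ∀ k, HasDerivAt (fun s => (P n s).coeff k) (D.coeff k) t := fun k => by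
    rw [hDc]; exact (hcoeff n k t ht).hasDerivAt
  have hD0 : ∀ k, n ≤ k + 1 → D.coeff k = 0 := fun k hk => by rw [hDc, hzero k hk]
  refine ⟨D, hderiv, hD0, fun q hq => ?_⟩
  have hsum := HasDerivAt.fun_sum (u := Finset.range (n + 1)) fun k _ =>
    (hderiv k).mul (hasDerivAt_laurentIntegral ht (X ^ k * q))
  have hev : (fun s => ∑ k ∈ Finset.range (n + 1),
      (P n s).coeff k * laurentIntegral s 0 (X ^ k * q)) =ᶠ[nhds t] fun _ => 0 := by
    filter_upwards [Ioi_mem_nhds ht] with s hs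
    rw [← laurentIntegral_mul_eq_sum hs 0 (by rw [(hP s hs).natDegree]; omega), mul_comm]
    exact (hP s hs).apply_mul_eq_zero hq
  have huniq := hsum.unique ((hasDerivAt_const t (0 : ℝ)).congr_of_eventuallyEq hev)
  have hDdeg : D.natDegree < n + 1 :=
    Nat.lt_succ_of_le (natDegree_le_iff_coeff_eq_zero.2 fun k hk => hD0 k (by omega))
  rw [laurentIntegral_mul_eq_sum ht 0 hDdeg,
    laurentIntegral_mul_eq_sum ht 2 (N := n + 1) (by rw [(hP t ht).natDegree]; omega)]
  simp only [mul_neg, Finset.sum_add_distrib, Finset.sum_neg_distrib] at huniq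
  linarith

/-- The derivative of the subleading coefficient of the `n`-th polynomial, expressed through the
polynomials of degrees `n, n - 1` and of degrees `n - 1, n - 2`. -/
lemma exists_hasDerivAt_subleading {P : ℕ → ℝ → ℝ[X]}
    (hP : ∀ s (hs : 0 < s), IsMonicOrthogonal (laurentIntegralₗ hs 0) (fun n => P n s))
    (hcoeff : ∀ n k : ℕ, ∀ t : ℝ, 0 < t → DifferentiableAt ℝ (fun s => (P n s).coeff k) t)
    (ht : 0 < t) (n : ℕ) :
    ∃ d : ℝ, HasDerivAt (fun s => (X ^ 2 * P (n + 1) s).coeff (n + 1)) d t ∧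
      d * laurentIntegral t 0 (P n t * P n t) =
        laurentIntegral t 1 (P (n + 1) t * P n t)
          - laurentIntegral t 2 (P (n + 1) t * P (n + 1) t) ∧
      ∀ m, n = m + 1 → d * laurentIntegral t 0 (P m t * P m t) =
        laurentIntegral t 1 (P (m + 1) t * P m t)
          - laurentIntegral t 0 (P (m + 1) t * P (m + 1) t) / laurentIntegral t 0 (P m t * P m t)
            * laurentIntegral t 2 (P m t * P m t) := by
  obtain ⟨D, hD, hD0, hDq⟩ := exists_hasDerivAt_coeff hP hcoeff ht (n + 1)
  have hp := hP t ht
  refine ⟨(X ^ 2 * D).coeff (n + 1), ?_, ?_, ?_⟩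
  · rcases n with _ | n
    · simpa [coeff_X_pow_mul'] using hasDerivAt_const t (0 : ℝ)
    · simpa only [coeff_X_pow_mul] using hD n
  · have h := hDq (X * P n t - P (n + 1) t) (fun k hk => by
      obtain ⟨k, rfl⟩ := Nat.exists_eq_succ_of_ne_zero (by omega : k ≠ 0)
      rw [Nat.succ_eq_add_one, coeff_sub, coeff_X_mul]
      rcases (by omega : n = k ∨ n < k) with rfl | hk
      · rw [hp.coeff_self, hp.coeff_self, sub_self]
      · rw [hp.coeff_of_lt hk, hp.coeff_of_lt (by omega), sub_zero])
    have h1 : laurentIntegral t 0 (D * P (n + 1) t) = 0 :=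
      hp.apply_mul_eq_zero fun k hk => hD0 k (by omega)
    have h2 : laurentIntegral t 0 (X * D * P n t)
        = (X * D).coeff n * laurentIntegral t 0 (P n t * P n t) :=
      hp.apply_mul_eq_coeff fun k hk => by
        obtain ⟨k, rfl⟩ := Nat.exists_eq_succ_of_ne_zero (by omega : k ≠ 0)
        rw [Nat.succ_eq_add_one, coeff_X_mul, hD0 k (by omega)]
    have e1 : D * (X * P n t - P (n + 1) t) = X * D * P n t - D * P (n + 1) t := by ring
    have e2 : P (n + 1) t * (X * P n t - P (n + 1) t)
        = X * (P (n + 1) t * P n t) - P (n + 1) t * P (n + 1) t := by ring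
    rw [e1, e2, laurentIntegral_sub ht, laurentIntegral_sub ht, laurentIntegral_X_mul, h1, h2,
      sub_zero] at h
    rw [show X ^ 2 * D = X * (X * D) by ring, coeff_X_mul, h]
  · rintro m rfl
    have h := hDq (P m t) (fun k hk => hp.coeff_of_lt (by omega))
    have h1 : laurentIntegral t 0 (D * P m t)
        = D.coeff m * laurentIntegral t 0 (P m t * P m t) :=
      hp.apply_mul_eq_coeff fun k hk => hD0 k (by omega)
    have h3 := hp.X_mul_succ (laurentIntegralₗ_comp_neg ht) m
    simp only [laurentIntegralₗ_apply] at h3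
    have e : P (m + 1 + 1) t * P m t = X * (P (m + 1) t * P m t)
        - C (laurentIntegral t 0 (P (m + 1) t * P (m + 1) t)
          / laurentIntegral t 0 (P m t * P m t)) * (P m t * P m t) := by
      linear_combination (-P m t) * h3
    rw [h1, e, laurentIntegral_sub ht, laurentIntegral_X_mul, laurentIntegral_C_mul ht] at h
    rw [coeff_X_pow_mul, h]

end Weight

theorem statement17
    (P : ℕ → ℝ → Polynomial ℝ)
    (hmonic : ∀ n : ℕ, ∀ t : ℝ, 0 < t → (P n t).Monic)
    (hdeg : ∀ n : ℕ, ∀ t : ℝ, 0 < t → (P n t).natDegree = n)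
    (horth : ∀ m n : ℕ, m ≠ n → ∀ t : ℝ, 0 < t →
      ∫ x : ℝ, (P m t).eval x * (P n t).eval x * w t x = 0)
    (hcoeff : ∀ n k : ℕ, ∀ t : ℝ, 0 < t →
      DifferentiableAt ℝ (fun s => (P n s).coeff k) t)
    (h : ℕ → ℝ → ℝ)
    (hh : ∀ n : ℕ, ∀ t : ℝ, 0 < t → h n t = ∫ x : ℝ, ((P n t).eval x) ^ 2 * w t x)
    (hhpos : ∀ n : ℕ, ∀ t : ℝ, 0 < t → 0 < h n t)
    (R : ℕ → ℝ → ℝ)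
    (hR : ∀ n : ℕ, ∀ t : ℝ, 0 < t →
      R n t = 2 * t / h n t * ∫ y : ℝ, ((P n t).eval y) ^ 2 / y ^ 2 * w t y)
    (r : ℕ → ℝ → ℝ)
    (hr : ∀ n : ℕ, 1 ≤ n → ∀ t : ℝ, 0 < t → r n t = 2 * t / h (n - 1) t *
      ∫ y : ℝ, (P n t).eval y * (P (n - 1) t).eval y / y ^ 3 * w t y)
    (σ : ℕ → ℝ → ℝ)
    (hσ : ∀ n : ℕ, ∀ t : ℝ, 0 < t → σ n t = -∑ j ∈ Finset.range n, R j t)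
    (n : ℕ) (hn : 1 ≤ n) (t₀ : ℝ) (ht₀ : 0 < t₀) :
    ∃ d : ℝ, HasDerivAt (σ n) d t₀ ∧
      (r n t₀) ^ 2 = σ n t₀ - 2 * t₀ * d + 2 * (1 - (-1 : ℝ) ^ n) * t₀ := by
  have hh' : ∀ n t, 0 < t → laurentIntegral t 0 (P n t * P n t) = h n t := fun n t ht => by
    rw [hh n t ht]; simp [laurentIntegral, sq]
  have hP : ∀ t (ht : 0 < t), IsMonicOrthogonal (laurentIntegralₗ ht 0) (fun n => P n t) :=
    fun t ht =>
    { monic := fun n => hmonic n t ht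
      natDegree := fun n => hdeg n t ht
      orthogonal := fun m n hmn => by
        rw [← horth m n hmn t ht]; simp [laurentIntegralₗ_apply, laurentIntegral]
      pos := fun n => by
        rw [laurentIntegralₗ_apply, hh' n t ht]; exact hhpos n t ht }
  set c : ℕ → ℝ → ℝ := fun n t => (X ^ 2 * P n t).coeff n with hc
  have hR' : ∀ n t, 0 < t → R n t * h n t = 2 * t * laurentIntegral t 2 (P n t * P n t) :=
    fun n t ht => by
      have := (hhpos n t ht).ne'
      rw [hR n t ht]
      simp only [laurentIntegral, eval_mul, sq]
      field_simp
  have hRc : ∀ n t, 0 < t → R n t = 2 * (c n t - c (n + 2) t) - (2 * n + 1) := fun n t ht => by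
    have h1 := (hP t ht).laurentIntegral_two_sq n
    rw [← hR' n t ht, hh' n t ht] at h1
    exact mul_right_cancel₀ (hhpos n t ht).ne' h1
  have hc0 : ∀ t, c 0 t = 0 := fun t => by simp [hc]
  have hc1 : ∀ t, c 1 t = 0 := fun t => by simp [hc, coeff_X_pow_mul']
  have hσc : ∀ n t, 0 < t → σ n t = n ^ 2 + 2 * c n t + 2 * c (n + 1) t := fun n t ht => by
    rw [hσ n t ht]
    induction n with
    | zero => simp [hc0, hc1]
    | succ n ih =>
      rw [Finset.sum_range_succ, neg_add, ih, hRc n t ht]; push_cast; ring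
  have hβ : ∀ n, h (n + 1) t₀ / h n t₀ = c (n + 1) t₀ - c (n + 2) t₀ := fun n => by
    rw [← hh' _ _ ht₀, ← hh' _ _ ht₀]; exact (hP t₀ ht₀).laurentIntegral_sq_div n
  have hrc : ∀ n, r (n + 1) t₀ = 2 * (c (n + 1) t₀ - c (n + 2) t₀) - (n + 1) := fun n => by
    have h1 := (hP t₀ ht₀).laurentIntegral_three_mul n
    have h0 := (hhpos n t₀ ht₀).ne'
    rw [hh' _ _ ht₀, hh' _ _ ht₀] at h1
    have h2 : r (n + 1) t₀ = 2 * t₀ / h n t₀ * laurentIntegral t₀ 3 (P (n + 1) t₀ * P n t₀) := by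
      rw [hr (n + 1) (by omega) t₀ ht₀]
      simp [laurentIntegral]
    rw [h2, div_mul_eq_mul_div, h1, ← hβ]
    field_simp
  choose d hd hd1 hd2 using exists_hasDerivAt_subleading hP hcoeff ht₀
  have hd1' : ∀ n, 2 * t₀ * d n
      = t₀ * (1 - (-1) ^ (n + 1)) - (c (n + 1) t₀ - c (n + 2) t₀) * R (n + 1) t₀ := fun n => by
    have h1 := hd1 n
    have h0 := (hhpos n t₀ ht₀).ne'
    rw [(hP t₀ ht₀).laurentIntegral_one_mul, hh' _ _ ht₀] at h1
    have h2 := hR' (n + 1) t₀ ht₀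
    rw [← hβ]
    field_simp
    linear_combination 2 * t₀ * h1 + h2
  have hd2' : ∀ n, 2 * t₀ * d (n + 1)
      = t₀ * (1 - (-1) ^ (n + 1)) - (c (n + 1) t₀ - c (n + 2) t₀) * R n t₀ := fun n => by
    have h1 := hd2 (n + 1) n rfl
    have h0 := (hhpos n t₀ ht₀).ne'
    rw [(hP t₀ ht₀).laurentIntegral_one_mul, hh' _ _ ht₀, hh' _ _ ht₀, hβ] at h1
    have h2 := hR' n t₀ ht₀
    refine mul_right_cancel₀ h0 ?_
    linear_combination 2 * t₀ * h1 + (c (n + 1) t₀ - c (n + 2) t₀) * h2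
  have hd0 : d 0 = 0 := (hd 0).unique (by
    have e : (fun s => (X ^ 2 * P (0 + 1) s).coeff (0 + 1)) = fun _ => (0 : ℝ) := funext hc1
    rw [e]; exact hasDerivAt_const t₀ 0)
  have hquad : ∀ n, r (n + 1) t₀ ^ 2 + 2 * (1 - (-1) ^ (n + 1)) * t₀ - σ (n + 1) t₀
      = 2 * (c (n + 1) t₀ - c (n + 2) t₀) * (R (n + 1) t₀ + R n t₀) := fun n => by
    induction n with
    | zero =>
      have h1 := hd1' 0
      rw [hd0] at h1
      have h2 := hRc 0 t₀ ht₀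
      have h3 := hrc 0
      have h4 := hσc 1 t₀ ht₀
      simp only [hc0, hc1, zero_add, Nat.cast_zero, Nat.cast_one] at h1 h2 h3 h4 ⊢
      rw [h3, h4, h2]
      linear_combination (-2) * h1
    | succ n ih =>
      have h1 := hd1' (n + 1)
      have h2 := hd2' n
      have h3 : r (n + 2) t₀ + r (n + 1) t₀ = R (n + 1) t₀ := by
        rw [hrc, hrc, hRc _ _ ht₀]; push_cast; ring
      have h4 : r (n + 2) t₀ - r (n + 1) t₀
          = 2 * (c (n + 2) t₀ - c (n + 3) t₀) - 2 * (c (n + 1) t₀ - c (n + 2) t₀) - 1 := by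
        rw [hrc, hrc]; push_cast; ring
      have h5 : σ (n + 2) t₀ = σ (n + 1) t₀ - R (n + 1) t₀ := by
        rw [hσ _ _ ht₀, hσ _ _ ht₀, Finset.sum_range_succ]; ring
      linear_combination ih + (r (n + 2) t₀ - r (n + 1) t₀) * h3 + R (n + 1) t₀ * h4 - h5
        - 2 * h1 + 2 * h2
  obtain ⟨n, rfl⟩ := Nat.exists_eq_add_of_le' hn
  refine ⟨2 * d n + 2 * d (n + 1), ?_, ?_⟩
  · refine ((((hd n).const_mul 2).add ((hd (n + 1)).const_mul 2)).const_add
      (((n + 1 : ℕ) : ℝ) ^ 2)).congr_of_eventuallyEq ?_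
    filter_upwards [Ioi_mem_nhds ht₀] with t ht
    rw [hσc _ _ ht]
    simp [hc, add_assoc]
  · linear_combination hquad n + 2 * hd1' n + 2 * hd2' n
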